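/- Let L be a commutative integral quantale with ⊥ ≠ ⊤, X a set, and G an L-gauge on X such that δ_G(x,{y}) = ⊤ for all x,y ∈ X with x ≠ y, where δ_G(x,A) = ⨅_{d ∈ G} ⨆_{a ∈ A} d(x,a). Then (X,G) is D-connected: for every set Y, every map f : X → Y which is a contraction into the discrete L-gauge space on Y (i.e., such that for every L-metric e on Y the map (x₁,x₂) ↦ e(f(x₁),f(x₂)) belongs to G) is constant. -/

import Mathlib

/-- A commutative integral quantale structure on a complete lattice `L`. -/
structure IsCIQuantale {L : Type*} [CompleteLattice L] (mul : L → L → L) : Prop where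
  comm : ∀ a b : L, mul a b = mul b a
  assoc : ∀ a b c : L, mul (mul a b) c = mul a (mul b c)
  distrib : ∀ (a : L) (s : Set L), mul a (sSup s) = ⨆ b ∈ s, mul a b
  mul_top : ∀ a : L, mul a ⊤ = a

/-- An `L`-metric on `X`. -/
def IsLMetric {L X : Type*} [CompleteLattice L] (mul : L → L → L) (d : X → X → L) : Prop :=
  (∀ x, d x x = ⊤) ∧ ∀ x y z, mul (d x y) (d y z) ≤ d x z

/-- `α` is well-below `⊤`. -/
def WellBelowTop {L : Type*} [CompleteLattice L] (α : L) : Prop :=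
  ∀ S : Set L, (⊤ : L) ≤ sSup S → ∃ γ ∈ S, α ≤ γ

/-- `ω` is well-above `⊥`. -/
def WellAboveBot {L : Type*} [CompleteLattice L] (ω : L) : Prop :=
  ∀ S : Set L, sInf S ≤ (⊥ : L) → ∃ γ ∈ S, γ ≤ ω

/-- A map is locally supported by a set `H` of `L`-metrics. -/
def LocallySupported {L X : Type*} [CompleteLattice L] (mul : L → L → L)
    (H : Set (X → X → L)) (d : X → X → L) : Prop :=
  ∀ (x : X) (α ω : L), WellBelowTop α → WellAboveBot ω →
    ∃ e ∈ H, ∀ y : X, mul (e x y) α ≤ d x y ⊔ ω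

/-- An `L`-gauge on `X`. -/
structure IsLGauge {L X : Type*} [CompleteLattice L] (mul : L → L → L)
    (G : Set (X → X → L)) : Prop where
  nonempty : G.Nonempty
  metric : ∀ d ∈ G, IsLMetric mul d
  up_closed : ∀ d ∈ G, ∀ e : X → X → L, IsLMetric mul e → (∀ x y, d x y ≤ e x y) → e ∈ G
  meet_closed : ∀ d ∈ G, ∀ e ∈ G, (fun x y => d x y ⊓ e x y) ∈ G
  saturated : ∀ d : X → X → L, IsLMetric mul d → LocallySupported mul G d → d ∈ G

/-- The `L`-approach distance induced by an `L`-gauge. -/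
def gaugeDelta {L X : Type*} [CompleteLattice L] (G : Set (X → X → L)) :
    X → Set X → L :=
  fun x A => ⨅ d ∈ G, ⨆ a ∈ A, d x a

/-- If `δ_G(x,{y}) = ⊤` for all `x ≠ y`, then `(X,G)` is `D`-connected: every
contraction from `(X,G)` into a discrete `L`-gauge space is constant. -/
theorem dConnected_of_gaugeDelta_top {L X Y : Type*} [CompleteLattice L]
    (mul : L → L → L) (hq : IsCIQuantale mul) (hnt : (⊥ : L) ≠ ⊤)
    (G : Set (X → X → L)) (hG : IsLGauge mul G)
    (hδ : ∀ x y : X, x ≠ y → gaugeDelta G x {y} = ⊤)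
    (f : X → Y)
    (hf : ∀ e : Y → Y → L, IsLMetric mul e → (fun x₁ x₂ : X => e (f x₁) (f x₂)) ∈ G) :
    ∀ x y : X, f x = f y := by
  classical
  intro x y
  by_contra hne
  have hxy : x ≠ y := fun h => hne (congrArg f h)
  have hbot : ∀ a : L, mul a ⊥ = ⊥ := by
    intro a
    have h := hq.distrib a ∅
    simpa using h
  have he : IsLMetric mul (fun a b : Y => if a = b then (⊤ : L) else ⊥) := by
    refine ⟨fun a => by simp, fun a b c => ?_⟩
    by_cases h1 : a = b
    · subst h1
      simp only [if_true]
      rw [hq.comm, hq.mul_top]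
    · simp only [if_neg h1]
      rw [hq.comm, hbot]
      exact bot_le
  have hm := hf _ he
  have h := hδ x y hxy
  have h2 : gaugeDelta G x {y} ≤ ⊥ := by
    unfold gaugeDelta
    refine (iInf₂_le _ hm).trans ?_
    simp [hne]
  rw [h] at h2
  exact hnt (le_bot_iff.mp h2).symm
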